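/- Let G be an infinite countable amenable group with a Følner sequence (F_n) of symmetric sets containing the identity. For every ε ∈ (0,1) there exists a positive integer r = r(ε) such that for every positive integer n_0 there exist indices n_0 < n_1 < ⋯ < n_r and an ε-disjoint, (1-ε)-covering quasitiling 𝒯 of G whose collection of shapes is exactly {F_{n_1}, …, F_{n_r}}. -/

import Mathlib

open scoped Pointwise symmDiff Classical
open Filter

namespace AmenableTilings

variable {G : Type*}

/-- The left translate `gF` of a finite set `F`. -/
noncomputable def lMul [Group G] (g : G) (F : Finset G) : Finset G := F.image (fun h => g * h)

/-- The right translate `Fg` of a finite set `F`. -/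
noncomputable def rMul [Group G] (F : Finset G) (g : G) : Finset G := F.image (fun h => h * g)

/-- A Følner sequence: a sequence of finite nonempty sets with `|gFₙ Δ Fₙ|/|Fₙ| → 0`
for every `g`. -/
def IsFolnerSeq [Group G] (F : ℕ → Finset G) : Prop :=
  (∀ n, (F n).Nonempty) ∧
  ∀ g : G, Tendsto (fun n => (((lMul g (F n)) ∆ (F n)).card : ℝ) / ((F n).card : ℝ))
    atTop (nhds 0)

/-- A group is amenable if it admits a Følner sequence. -/
def IsAmenable (G : Type*) [Group G] : Prop := ∃ F : ℕ → Finset G, IsFolnerSeq F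

/-- `(K,ε)`-invariance: `|KT Δ T| < ε|T|`, where `KT = {gh : g ∈ K, h ∈ T}`. -/
def KInvariant [Group G] (K T : Finset G) (ε : ℝ) : Prop :=
  (((K * T) ∆ T).card : ℝ) < ε * (T.card : ℝ)

/-- `|S ∩ Fg|`. -/
noncomputable def interCard [Group G] (S : Set G) (F : Finset G) (g : G) : ℕ :=
  ((rMul F g).filter (fun h => h ∈ S)).card

/-- `D̲_F(S) = inf_g |S ∩ Fg| / |F|`. -/
noncomputable def lowerD [Group G] (S : Set G) (F : Finset G) : ℝ :=
  ⨅ g : G, (interCard S F g : ℝ) / (F.card : ℝ)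

/-- `D̄_F(S) = sup_g |S ∩ Fg| / |F|`. -/
noncomputable def upperD [Group G] (S : Set G) (F : Finset G) : ℝ :=
  ⨆ g : G, (interCard S F g : ℝ) / (F.card : ℝ)

/-- Lower Banach density: `sup { D̲_F(S) : F finite nonempty }`. -/
noncomputable def lowerBD [Group G] (S : Set G) : ℝ :=
  sSup {r : ℝ | ∃ F : Finset G, F.Nonempty ∧ r = lowerD S F}

/-- Upper Banach density: `inf { D̄_F(S) : F finite nonempty }`. -/
noncomputable def upperBD [Group G] (S : Set G) : ℝ :=
  sInf {r : ℝ | ∃ F : Finset G, F.Nonempty ∧ r = upperD S F}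

/-- The shift action of `G` on `Λ^G`: `(gx)(h) = x(hg)`. -/
def shift [Group G] {Λ : Type*} (g : G) (x : G → Λ) : G → Λ := fun h => x (h * g)

/-- The orbit closure of `x ∈ Λ^G` under the shift action (with `Λ` discrete and
`Λ^G` carrying the product topology). -/
noncomputable def orbitClosure [Group G] {Λ : Type*} (x : G → Λ) : Set (G → Λ) :=
  @closure _ (@Pi.topologicalSpace G (fun _ => Λ) (fun _ => ⊥)) {y | ∃ g : G, y = shift g x}

/-- `N_X(F)`: the number of blocks with domain `F` occurring in `X`. -/
noncomputable def complexity [Group G] {Λ : Type*} (X : Set (G → Λ)) (F : Finset G) : ℕ :=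
  Set.ncard ((fun x (f : {a // a ∈ F}) => x f.1) '' X)

/-- Topological entropy of a symbolic system:
`inf { (1/|F|) log₂ N_X(F) : F finite nonempty }`. -/
noncomputable def entropyOf [Group G] {Λ : Type*} (X : Set (G → Λ)) : ℝ :=
  sInf {r : ℝ | ∃ F : Finset G, F.Nonempty ∧
    r = Real.logb 2 (complexity X F) / (F.card : ℝ)}

/-- The entropy of (the shift-orbit closure of) a symbolic element. -/
noncomputable def pointEntropy [Group G] {Λ : Type*} (x : G → Λ) : ℝ :=
  entropyOf (orbitClosure x)

/-- A quasitiling of `G`: finitely many finite shapes containing the identity,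
with pairwise disjoint center sets, such that the map `(S,c) ↦ Sc` is injective. -/
structure Quasitiling (G : Type*) [Group G] where
  shapes : Finset (Finset G)
  centers : Finset G → Set G
  one_mem : ∀ S ∈ shapes, (1 : G) ∈ S
  centers_empty : ∀ S, S ∉ shapes → centers S = ∅
  centers_disjoint : ∀ S ∈ shapes, ∀ S' ∈ shapes, S ≠ S' → Disjoint (centers S) (centers S')
  tiles_inj : ∀ S ∈ shapes, ∀ S' ∈ shapes, ∀ c ∈ centers S, ∀ c' ∈ centers S',
    rMul S c = rMul S' c' → S = S' ∧ c = c'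

namespace Quasitiling

variable [Group G]

/-- `(S,c)` is a tile of the quasitiling. -/
def IsTile (𝒯 : Quasitiling G) (S : Finset G) (c : G) : Prop :=
  S ∈ 𝒯.shapes ∧ c ∈ 𝒯.centers S

/-- The union of all tiles of the quasitiling. -/
def union (𝒯 : Quasitiling G) : Set G :=
  ⋃ S ∈ 𝒯.shapes, ⋃ c ∈ 𝒯.centers S, (↑(rMul S c) : Set G)

/-- `f` witnesses `ε`-disjointness: it assigns to each tile a `(1-ε)`-subset, and the
assigned subsets of distinct tiles are pairwise disjoint. -/
def EpsDisjointWith (𝒯 : Quasitiling G) (ε : ℝ) (f : Finset G → G → Finset G) : Prop :=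
  (∀ S c, 𝒯.IsTile S c →
    f S c ⊆ rMul S c ∧ (1 - ε) * (S.card : ℝ) ≤ ((f S c).card : ℝ)) ∧
  (∀ S c S' c', 𝒯.IsTile S c → 𝒯.IsTile S' c' → (S, c) ≠ (S', c') →
    Disjoint (f S c) (f S' c'))

/-- `ε`-disjointness of a quasitiling. -/
def EpsDisjoint (𝒯 : Quasitiling G) (ε : ℝ) : Prop := ∃ f, 𝒯.EpsDisjointWith ε f

/-- The tiles are pairwise disjoint. -/
def TilesDisjoint (𝒯 : Quasitiling G) : Prop :=
  ∀ S c S' c', 𝒯.IsTile S c → 𝒯.IsTile S' c' → (S, c) ≠ (S', c') →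
    Disjoint (rMul S c) (rMul S' c')

/-- `α`-covering: the union of the tiles has lower Banach density at least `α`. -/
def Covering (𝒯 : Quasitiling G) (α : ℝ) : Prop := α ≤ lowerBD 𝒯.union

/-- An exact tiling: the tiles form a partition of `G`. -/
def IsExactTiling (𝒯 : Quasitiling G) : Prop := 𝒯.TilesDisjoint ∧ 𝒯.union = Set.univ

/-- The symbolic representation `x_𝒯` of a quasitiling, over the alphabet
`𝒮(𝒯) ∪ {0}` (encoded as `Option (Finset G)`, with `none` playing the role of `0`):
`x_𝒯(g) = S` iff `g ∈ C(S)`. -/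
noncomputable def symb (𝒯 : Quasitiling G) : G → Option (Finset G) :=
  fun g => if h : ∃ S, S ∈ 𝒯.shapes ∧ g ∈ 𝒯.centers S then some h.choose else none

/-- The entropy of a quasitiling: the topological entropy of the shift-orbit closure of
its symbolic representation. -/
noncomputable def entropy (𝒯 : Quasitiling G) : ℝ := pointEntropy 𝒯.symb

end Quasitiling

/-- `𝒯'` is congruent with `𝒯` (each tile of `𝒯'` is a union of tiles of `𝒯`). -/
def Congruent [Group G] (𝒯 𝒯' : Quasitiling G) : Prop :=
  ∀ S c, 𝒯'.IsTile S c → ∃ P : Set (Finset G × G),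
    (∀ p ∈ P, 𝒯.IsTile p.1 p.2) ∧
    (↑(rMul S c) : Set G) = ⋃ p ∈ P, (↑(rMul p.1 p.2) : Set G)

/-- The union over all tiles `(S,c)` of the assigned subsets `f S c`. -/
def subUnion [Group G] (𝒯 : Quasitiling G) (f : Finset G → G → Finset G) : Set G :=
  ⋃ S ∈ 𝒯.shapes, ⋃ c ∈ 𝒯.centers S, (↑(f S c) : Set G)

end AmenableTilings
namespace AmenableTilings

section Auxiliary

variable {G : Type*} [Group G]

theorem rMul_eq_mul_singleton (F : Finset G) (g : G) : rMul F g = F * {g} :=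
  (Finset.image₂_singleton_right).symm

theorem card_rMul (F : Finset G) (g : G) : (rMul F g).card = F.card := by
  rw [rMul_eq_mul_singleton, Finset.card_mul_singleton]

theorem mem_rMul {F : Finset G} {g x : G} : x ∈ rMul F g ↔ ∃ h ∈ F, h * g = x :=
  Finset.mem_image

theorem self_mem_rMul {F : Finset G} (hF : (1 : G) ∈ F) (g : G) : g ∈ rMul F g :=
  mem_rMul.2 ⟨1, hF, one_mul g⟩

theorem card_mul_rMul_sdiff (K F : Finset G) (g : G) :
    ((K * rMul F g) \ rMul F g).card = ((K * F) \ F).card := by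
  have h : (K * rMul F g) \ rMul F g = rMul ((K * F) \ F) g := by
    have hinj : Function.Injective (fun h : G => h * g) := mul_left_injective g
    rw [rMul_eq_mul_singleton, ← mul_assoc, ← rMul_eq_mul_singleton, ← rMul_eq_mul_singleton]
    exact (Finset.image_sdiff _ _ hinj).symm
  rw [h, card_rMul]

theorem mem_union_iff {𝒯 : Quasitiling G} {x : G} :
    x ∈ 𝒯.union ↔ ∃ S c, 𝒯.IsTile S c ∧ x ∈ rMul S c := by
  simp only [Quasitiling.union, Quasitiling.IsTile, Set.mem_iUnion, Finset.mem_coe]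
  constructor
  · rintro ⟨S, hS, c, hc, hx⟩
    exact ⟨S, c, ⟨hS, hc⟩, hx⟩
  · rintro ⟨S, c, ⟨hS, hc⟩, hx⟩
    exact ⟨S, hS, c, hc, hx⟩

namespace IsFolnerSeq

variable {F : ℕ → Finset G}

theorem eventually_card_mul_sdiff_le (hF : IsFolnerSeq F) (K : Finset G) {δ : ℝ} (hδ : 0 < δ) :
    ∀ᶠ n in atTop, (((K * F n) \ F n).card : ℝ) ≤ δ * (F n).card := by
  have hη : 0 < δ / (K.card + 1) := by positivity
  have hev : ∀ᶠ n in atTop, ∀ g ∈ K,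
      (((lMul g (F n)) ∆ (F n)).card : ℝ) / (F n).card < δ / (K.card + 1) :=
    (Filter.eventually_all_finset K).2 fun g _ => (hF.2 g).eventually (gt_mem_nhds hη)
  filter_upwards [hev] with n hn
  have hpos : (0 : ℝ) < (F n).card := by exact_mod_cast (hF.1 n).card_pos
  have hsub : (K * F n) \ F n ⊆ K.biUnion fun g => (lMul g (F n)) ∆ (F n) := by
    intro x hx
    obtain ⟨hx, hxF⟩ := Finset.mem_sdiff.1 hx
    obtain ⟨g, hg, h, hh, rfl⟩ := Finset.mem_mul.1 hx
    refine Finset.mem_biUnion.2 ⟨g, hg, Finset.mem_symmDiff.2 (Or.inl ⟨?_, hxF⟩)⟩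
    exact Finset.mem_image.2 ⟨h, hh, rfl⟩
  calc (((K * F n) \ F n).card : ℝ)
      ≤ ((K.biUnion fun g => (lMul g (F n)) ∆ (F n)).card : ℝ) := by
        exact_mod_cast Finset.card_le_card hsub
    _ ≤ ∑ g ∈ K, (((lMul g (F n)) ∆ (F n)).card : ℝ) := by
        exact_mod_cast Finset.card_biUnion_le
    _ ≤ ∑ _g ∈ K, δ / (K.card + 1) * (F n).card :=
        Finset.sum_le_sum fun g hg => ((div_lt_iff₀ hpos).1 (hn g hg)).le
    _ = (K.card / (K.card + 1)) * (δ * (F n).card) := by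
        rw [Finset.sum_const, nsmul_eq_mul]; ring
    _ ≤ 1 * (δ * (F n).card) := by
        gcongr
        rw [div_le_one (by positivity)]
        linarith
    _ = δ * (F n).card := one_mul _

theorem eventually_ne [Infinite G] (hF : IsFolnerSeq F) (hone : ∀ n, (1 : G) ∈ F n)
    (S : Finset G) : ∀ᶠ n in atTop, S ≠ F n := by
  obtain ⟨g, hg⟩ := Infinite.exists_notMem_finset S
  have hpos : (0 : ℝ) < 1 / (S.card + 1) := by positivity
  filter_upwards [(hF.2 g).eventually (gt_mem_nhds hpos)] with n hn h
  subst h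
  have hS : (0 : ℝ) < (F n).card := by exact_mod_cast (hF.1 n).card_pos
  have hmem : g ∈ (lMul g (F n)) ∆ (F n) :=
    Finset.mem_symmDiff.2 (Or.inl ⟨Finset.mem_image.2 ⟨1, hone n, mul_one g⟩, hg⟩)
  have hcard : (1 : ℝ) ≤ ((lMul g (F n)) ∆ (F n)).card := by
    exact_mod_cast Finset.card_pos.2 ⟨g, hmem⟩
  have : (1 : ℝ) / (F n).card ≤ (((lMul g (F n)) ∆ (F n)).card : ℝ) / (F n).card := by gcongr
  have : (1 : ℝ) / ((F n).card + 1) ≤ 1 / (F n).card := by gcongr; linarith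
  linarith

/-- A Følner sequence has subsequences of pairwise distinct sets, each of which is as invariant
as one likes under all the previous ones. -/
theorem exists_invariant_subseq [Infinite G] (hF : IsFolnerSeq F) (hone : ∀ n, (1 : G) ∈ F n)
    {δ : ℝ} (hδ : 0 < δ) (n₀ : ℕ) :
    ∃ φ : ℕ → ℕ, StrictMono φ ∧ (∀ i, n₀ < φ i) ∧ ∀ i j, i < j → F (φ i) ≠ F (φ j) ∧
      ((((F (φ i))⁻¹ * F (φ j)) \ F (φ j)).card : ℝ) ≤ δ * (F (φ j)).card := by
  obtain ⟨φ, hφ₀, hφ⟩ := exists_seq_of_forall_finset_exists (fun n => n₀ < n)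
    (fun a b => a < b ∧ F a ≠ F b ∧ ((((F a)⁻¹ * F b) \ F b).card : ℝ) ≤ δ * (F b).card) (by
      intro s _
      have hs : ∀ᶠ b in atTop, ∀ a ∈ s,
          a < b ∧ F a ≠ F b ∧ ((((F a)⁻¹ * F b) \ F b).card : ℝ) ≤ δ * (F b).card :=
        (Filter.eventually_all_finset s).2 fun a _ => (eventually_gt_atTop a).and
          ((hF.eventually_ne hone (F a)).and (hF.eventually_card_mul_sdiff_le _ hδ))
      exact ((eventually_gt_atTop n₀).and hs).exists)
  exact ⟨φ, fun i j hij => (hφ i j hij).1, hφ₀, fun i j hij => (hφ i j hij).2⟩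

end IsFolnerSeq

/-- A set of a countable type can be selected greedily: membership of `g` is decided by an
arbitrary condition on the set of previously selected elements. -/
theorem exists_greedy_set {α : Type*} (e : α → ℕ) (Q : α → Set α → Prop) :
    ∃ C : Set α, ∀ g, g ∈ C ↔ Q g {c | c ∈ C ∧ e c < e g} := by
  let wf := (measure e).wf
  let C : α → Prop := wf.fix fun g rec => Q g {c | ∃ h : e c < e g, rec c h}
  refine ⟨{g | C g}, fun g => ?_⟩
  have h : C g = Q g {c | ∃ _ : e c < e g, C c} := wf.fix_eq _ g
  have hset : {c | ∃ _ : e c < e g, C c} = {c | c ∈ {g | C g} ∧ e c < e g} := by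
    ext c
    simp [and_comm]
  rw [Set.mem_ofPred_eq, h, hset]

/-- Translates of `S` with centers in `A` can be chosen `ε`-disjoint so that their union covers an
`ε`-fraction of each translate of `S` with center in `A`. -/
theorem exists_epsDisjoint_centers [Countable G] (S : Finset G) (hS : S.Nonempty) (A : Set G)
    {ε : ℝ} (hε : ε ∈ Set.Ioo (0 : ℝ) 1) :
    ∃ (C : Set G) (f : G → Finset G), C ⊆ A ∧
      (∀ c ∈ C, f c ⊆ rMul S c ∧ (1 - ε) * (S.card : ℝ) ≤ (f c).card) ∧
      (∀ c ∈ C, ∀ c' ∈ C, c ≠ c' → Disjoint (f c) (f c')) ∧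
      (∀ c ∈ C, ∀ c' ∈ C, rMul S c = rMul S c' → c = c') ∧
      ∀ g ∈ A, ε * (S.card : ℝ) ≤ ((rMul S g).filter (fun x => ∃ c ∈ C, x ∈ rMul S c)).card := by
  have hSpos : (0 : ℝ) < S.card := by exact_mod_cast hS.card_pos
  obtain ⟨e, he⟩ := Countable.exists_injective_nat G
  obtain ⟨C, hC⟩ := exists_greedy_set e (fun g D => g ∈ A ∧
    (1 - ε) * (S.card : ℝ) ≤ ((rMul S g).filter (fun x => ¬ ∃ c ∈ D, x ∈ rMul S c)).card)
  set f : G → Finset G := fun g =>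
    (rMul S g).filter (fun x => ¬ ∃ c ∈ {c | c ∈ C ∧ e c < e g}, x ∈ rMul S c) with hf
  have hdisj : ∀ c ∈ C, ∀ c', e c < e c' → Disjoint (rMul S c) (f c') := by
    intro c hc c' hlt
    rw [Finset.disjoint_right]
    intro x hx hxc
    exact (Finset.mem_filter.1 hx).2 ⟨c, ⟨hc, hlt⟩, hxc⟩
  have hsub : ∀ c, f c ⊆ rMul S c := fun c => Finset.filter_subset _ _
  have hcard : ∀ c ∈ C, (1 - ε) * (S.card : ℝ) ≤ (f c).card := fun c hc => ((hC c).1 hc).2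
  have hinj : ∀ c ∈ C, ∀ c' ∈ C, rMul S c = rMul S c' → ¬ e c < e c' := by
    intro c hc c' hc' h hlt
    have h1 := hdisj c hc c' hlt
    rw [h] at h1
    have h2 : f c' = ∅ := Finset.disjoint_self_iff_empty _ |>.1 (h1.mono_left (hsub c'))
    have h3 := hcard c' hc'
    rw [h2, Finset.card_empty, Nat.cast_zero] at h3
    nlinarith [hε.2]
  refine ⟨C, f, fun g hg => ((hC g).1 hg).1, fun c hc => ⟨hsub c, hcard c hc⟩, ?_, ?_, ?_⟩
  · intro c hc c' hc' hne
    rcases lt_trichotomy (e c) (e c') with h | h | h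
    · exact (hdisj c hc c' h).mono_left (hsub c)
    · exact absurd (he h) hne
    · exact ((hdisj c' hc' c h).mono_left (hsub c')).symm
  · intro c hc c' hc' h
    exact he (le_antisymm (not_lt.1 (hinj c' hc' c hc h.symm)) (not_lt.1 (hinj c hc c' hc' h)))
  · intro g hg
    by_cases hgC : g ∈ C
    · have : (rMul S g).filter (fun x => ∃ c ∈ C, x ∈ rMul S c) = rMul S g :=
        Finset.filter_true_of_mem fun x hx => ⟨g, hgC, hx⟩
      rw [this, card_rMul]
      nlinarith [hε.2]
    · have hlt : ((f g).card : ℝ) < (1 - ε) * S.card := by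
        by_contra! h
        exact hgC ((hC g).2 ⟨hg, h⟩)
      have hle : S.card ≤
          ((rMul S g).filter (fun x => ∃ c ∈ C, x ∈ rMul S c)).card + (f g).card := by
        rw [← card_rMul S g]
        refine (Finset.card_le_card fun x hx => ?_).trans (Finset.card_union_le _ _)
        by_cases h : ∃ c ∈ C, x ∈ rMul S c
        · exact Finset.mem_union_left _ (Finset.mem_filter.2 ⟨hx, h⟩)
        · refine Finset.mem_union_right _ (Finset.mem_filter.2 ⟨hx, ?_⟩)
          rintro ⟨c, hc, hxc⟩
          exact h ⟨c, hc.1, hxc⟩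
      have hle' : (S.card : ℝ) ≤
          ((rMul S g).filter (fun x => ∃ c ∈ C, x ∈ rMul S c)).card + (f g).card := by
        exact_mod_cast hle
      linarith

/-- An `ε`-disjoint quasitiling can be enlarged by tiles of a new shape `S` lying outside its union,
so that every translate of `S` outside that union has an `ε`-fraction covered. -/
theorem exists_insert_shape [Countable G] (𝒯 : Quasitiling G) {ε : ℝ}
    (hε : ε ∈ Set.Ioo (0 : ℝ) 1) (h𝒯 : 𝒯.EpsDisjoint ε) (S : Finset G) (hS : (1 : G) ∈ S)
    (hS𝒯 : S ∉ 𝒯.shapes) :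
    ∃ 𝒯' : Quasitiling G, 𝒯'.shapes = insert S 𝒯.shapes ∧ 𝒯'.EpsDisjoint ε ∧
      𝒯.union ⊆ 𝒯'.union ∧
      ∀ g, (∀ x ∈ rMul S g, x ∉ 𝒯.union) →
        ε * (S.card : ℝ) ≤ ((rMul S g).filter (fun x => x ∈ 𝒯'.union)).card := by
  obtain ⟨f₀, hf₀, hf₀d⟩ := h𝒯
  obtain ⟨C, f, hCA, hf, hfd, hinj, hcov⟩ := exists_epsDisjoint_centers S ⟨1, hS⟩
    {g | ∀ x ∈ rMul S g, x ∉ 𝒯.union} hε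
  have hsep : ∀ c ∈ C, ∀ T d, 𝒯.IsTile T d → Disjoint (rMul S c) (rMul T d) := by
    intro c hc T d hTd
    rw [Finset.disjoint_left]
    intro x hx hx'
    exact hCA hc x hx (mem_union_iff.2 ⟨T, d, hTd, hx'⟩)
  have hneS : ∀ T ∈ 𝒯.shapes, T ≠ S := fun T hT h => hS𝒯 (h ▸ hT)
  let 𝒯' : Quasitiling G :=
    { shapes := insert S 𝒯.shapes
      centers := fun T => if T = S then C else 𝒯.centers T
      one_mem := by
        intro T hT
        rcases Finset.mem_insert.1 hT with rfl | hT
        exacts [hS, 𝒯.one_mem T hT]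
      centers_empty := by
        intro T hT
        rw [Finset.mem_insert, not_or] at hT
        rw [if_neg hT.1, 𝒯.centers_empty T hT.2]
      centers_disjoint := by
        have key : ∀ T ∈ 𝒯.shapes, Disjoint C (𝒯.centers T) := by
          intro T hT
          rw [Set.disjoint_left]
          intro c hc hc'
          exact Finset.disjoint_left.1 (hsep c hc T c ⟨hT, hc'⟩) (self_mem_rMul hS c)
            (self_mem_rMul (𝒯.one_mem T hT) c)
        intro T hT T' hT' hne
        rcases Finset.mem_insert.1 hT with rfl | hT₁ <;>
          rcases Finset.mem_insert.1 hT' with rfl | hT'₁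
        · exact absurd rfl hne
        · rw [if_pos rfl, if_neg hne.symm]
          exact key T' hT'₁
        · rw [if_pos rfl, if_neg hne]
          exact (key T hT₁).symm
        · rw [if_neg (hneS T hT₁), if_neg (hneS T' hT'₁)]
          exact 𝒯.centers_disjoint T hT₁ T' hT'₁ hne
      tiles_inj := by
        have key : ∀ c ∈ C, ∀ T ∈ 𝒯.shapes, ∀ d ∈ 𝒯.centers T, rMul S c ≠ rMul T d := by
          intro c hc T hT d hd h
          exact Finset.disjoint_left.1 (hsep c hc T d ⟨hT, hd⟩) (self_mem_rMul hS c)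
            (h ▸ self_mem_rMul hS c)
        intro T hT T' hT' c hc c' hc' h
        rcases Finset.mem_insert.1 hT with rfl | hT₁ <;>
          rcases Finset.mem_insert.1 hT' with rfl | hT'₁
        · rw [if_pos rfl] at hc hc'
          exact ⟨rfl, hinj c hc c' hc' h⟩
        · rw [if_pos rfl] at hc
          rw [if_neg (hneS T' hT'₁)] at hc'
          exact absurd h (key c hc T' hT'₁ c' hc')
        · rw [if_pos rfl] at hc'
          rw [if_neg (hneS T hT₁)] at hc
          exact absurd h.symm (key c' hc' T hT₁ c hc)
        · rw [if_neg (hneS T hT₁)] at hc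
          rw [if_neg (hneS T' hT'₁)] at hc'
          exact 𝒯.tiles_inj T hT₁ T' hT'₁ c hc c' hc' h }
  have htile : ∀ T c, 𝒯'.IsTile T c ↔ (T = S ∧ c ∈ C) ∨ 𝒯.IsTile T c := by
    intro T c
    simp only [Quasitiling.IsTile, 𝒯', Finset.mem_insert]
    by_cases h : T = S
    · subst h; simp [hS𝒯]
    · simp [h]
  refine ⟨𝒯', rfl, ⟨fun T c => if T = S then f c else f₀ T c, ?_, ?_⟩, ?_, ?_⟩
  · intro T c hT
    rcases (htile T c).1 hT with ⟨rfl, hc⟩ | hT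
    · simpa using hf c hc
    · simpa [hneS T hT.1] using hf₀ T c hT
  · intro T c T' c' hT hT' hne
    rcases (htile T c).1 hT with ⟨rfl, hc⟩ | hT₁ <;>
      rcases (htile T' c').1 hT' with ⟨rfl, hc'⟩ | hT'₁
    · simp only [if_true]
      exact hfd c hc c' hc' fun h => hne (by rw [h])
    · simp only [if_true, if_neg (hneS T' hT'₁.1)]
      exact (hsep c hc T' c' hT'₁).mono (hf c hc).1 (hf₀ T' c' hT'₁).1
    · simp only [if_true, if_neg (hneS T hT₁.1)]
      exact ((hsep c' hc' T c hT₁).mono (hf c' hc').1 (hf₀ T c hT₁).1).symm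
    · simp only [if_neg (hneS T hT₁.1), if_neg (hneS T' hT'₁.1)]
      exact hf₀d T c T' c' hT₁ hT'₁ hne
  · intro x hx
    obtain ⟨T, c, hT, hx⟩ := mem_union_iff.1 hx
    exact mem_union_iff.2 ⟨T, c, (htile T c).2 (Or.inr hT), hx⟩
  · intro g hg
    refine (hcov g hg).trans ?_
    norm_cast
    refine Finset.card_le_card (Finset.monotone_filter_right _ ?_)
    rintro x - ⟨c, hc, hx⟩
    exact mem_union_iff.2 ⟨S, c, (htile S c).2 (Or.inl ⟨rfl, hc⟩), hx⟩

/-- If the shapes of an `ε`-disjoint quasitiling are almost invariant under `K⁻¹`, then its union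
has a small `K⁻¹`-boundary in every finite window. -/
theorem card_boundary_le (𝒯 : Quasitiling G) {ε D : ℝ} (h𝒯 : 𝒯.EpsDisjoint ε) (hD : 0 ≤ D)
    (K : Finset G)
    (hK : ∀ T ∈ 𝒯.shapes, (((K⁻¹ * T) \ T).card : ℝ) ≤ D * ((1 - ε) * T.card))
    (W : Finset G) :
    ((W.filter (fun g => g ∉ 𝒯.union ∧ ∃ x ∈ rMul K g, x ∈ 𝒯.union)).card : ℝ) ≤
      D * ((𝒯.shapes.biUnion fun T => T * T⁻¹ * K) * W).card := by
  obtain ⟨f, hf, hfd⟩ := h𝒯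
  set P : Finset (Finset G × G) := (𝒯.shapes.biUnion fun T =>
    (T⁻¹ * K * W).image fun c => (T, c)).filter fun p => 𝒯.IsTile p.1 p.2 with hP
  have hPmem : ∀ p ∈ P, 𝒯.IsTile p.1 p.2 ∧ p.2 ∈ p.1⁻¹ * K * W := by
    intro p hp
    obtain ⟨hp, hpT⟩ := Finset.mem_filter.1 hp
    obtain ⟨T, -, hp⟩ := Finset.mem_biUnion.1 hp
    obtain ⟨c, hc, rfl⟩ := Finset.mem_image.1 hp
    exact ⟨hpT, hc⟩
  have hcover : W.filter (fun g => g ∉ 𝒯.union ∧ ∃ x ∈ rMul K g, x ∈ 𝒯.union) ⊆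
      P.biUnion fun p => (K⁻¹ * rMul p.1 p.2) \ rMul p.1 p.2 := by
    intro g hg
    obtain ⟨hgW, hgn, x, hx, hxU⟩ := Finset.mem_filter.1 hg
    obtain ⟨T, c, hT, hxT⟩ := mem_union_iff.1 hxU
    obtain ⟨k, hk, rfl⟩ := mem_rMul.1 hx
    obtain ⟨t, ht, htc⟩ := mem_rMul.1 hxT
    refine Finset.mem_biUnion.2 ⟨(T, c), Finset.mem_filter.2 ⟨Finset.mem_biUnion.2
      ⟨T, hT.1, Finset.mem_image.2 ⟨c, ?_, rfl⟩⟩, hT⟩, Finset.mem_sdiff.2 ⟨?_, ?_⟩⟩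
    · have hc : c = t⁻¹ * k * g := by rw [mul_assoc, ← htc, inv_mul_cancel_left]
      rw [hc]
      exact Finset.mul_mem_mul (Finset.mul_mem_mul (Finset.inv_mem_inv ht) hk) hgW
    · have hg' : g = k⁻¹ * (k * g) := by group
      rw [hg']
      exact Finset.mul_mem_mul (Finset.inv_mem_inv hk) hxT
    · exact fun h => hgn (mem_union_iff.2 ⟨T, c, hT, h⟩)
  have hfP : ∑ p ∈ P, ((f p.1 p.2).card : ℝ) ≤
      ((𝒯.shapes.biUnion fun T => T * T⁻¹ * K) * W).card := by
    have hd : (P : Set (Finset G × G)).PairwiseDisjoint fun p => f p.1 p.2 :=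
      fun p hp q hq hne => hfd p.1 p.2 q.1 q.2 (hPmem p hp).1 (hPmem q hq).1 hne
    norm_cast
    rw [← Finset.card_biUnion hd]
    refine Finset.card_le_card (Finset.biUnion_subset.2 fun p hp => ?_)
    obtain ⟨hT, hc⟩ := hPmem p hp
    intro x hx
    obtain ⟨t, ht, rfl⟩ := mem_rMul.1 ((hf p.1 p.2 hT).1 hx)
    have h1 : t * p.2 ∈ p.1 * (p.1⁻¹ * K * W) := Finset.mul_mem_mul ht hc
    rw [← mul_assoc, ← mul_assoc] at h1
    exact Finset.mul_subset_mul_right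
      (Finset.subset_biUnion_of_mem (fun T => T * T⁻¹ * K) hT.1) h1
  calc ((W.filter (fun g => g ∉ 𝒯.union ∧ ∃ x ∈ rMul K g, x ∈ 𝒯.union)).card : ℝ)
      ≤ ∑ p ∈ P, (((K⁻¹ * rMul p.1 p.2) \ rMul p.1 p.2).card : ℝ) := by
        exact_mod_cast (Finset.card_le_card hcover).trans Finset.card_biUnion_le
    _ ≤ ∑ p ∈ P, D * ((f p.1 p.2).card : ℝ) := by
        refine Finset.sum_le_sum fun p hp => ?_
        have hT := (hPmem p hp).1
        rw [card_mul_rMul_sdiff]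
        exact (hK p.1 hT.1).trans (mul_le_mul_of_nonneg_left (hf p.1 p.2 hT).2 hD)
    _ ≤ _ := by
        rw [← Finset.mul_sum]
        exact mul_le_mul_of_nonneg_left hfP hD

/-- If a property `N` holds on at least an `ε`-fraction of each translate `Sg`, `g ∈ A`, where `A`
lies in a finite window `W`, then it holds at no fewer than `ε|A|` points of `W`, up to the
`S`-boundary of `W`. -/
theorem mul_card_le_card_add_boundary (S : Finset G) (hS : S.Nonempty) (W A : Finset G)
    (hA : A ⊆ W) (N : G → Prop) [DecidablePred N] {ε : ℝ}
    (hN : ∀ g ∈ A, ε * (S.card : ℝ) ≤ ((rMul S g).filter N).card) :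
    ε * A.card ≤ ((W.filter N).card : ℝ) + ((S * W) \ W).card := by
  have hSpos : (0 : ℝ) < S.card := by exact_mod_cast hS.card_pos
  have hcount : A.card • (ε * (S.card : ℝ)) ≤
      ((S * W).filter N).card • (S.card : ℝ) := by
    refine Finset.card_nsmul_le_card_nsmul (fun g x => x ∈ rMul S g) ?_ ?_
    · intro g hg
      refine (hN g hg).trans ?_
      norm_cast
      refine Finset.card_le_card fun x hx => ?_
      obtain ⟨hx, hxN⟩ := Finset.mem_filter.1 hx
      refine (Finset.mem_bipartiteAbove _).2 ⟨Finset.mem_filter.2 ⟨?_, hxN⟩, hx⟩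
      obtain ⟨s, hs, rfl⟩ := mem_rMul.1 hx
      exact Finset.mul_mem_mul hs (hA hg)
    · intro x _
      norm_cast
      rw [← Finset.card_inv S, ← card_rMul S⁻¹ x]
      refine Finset.card_le_card fun g hg => ?_
      obtain ⟨s, hs, rfl⟩ := mem_rMul.1 ((Finset.mem_bipartiteBelow _).1 hg).2
      exact mem_rMul.2 ⟨s⁻¹, Finset.inv_mem_inv hs, inv_mul_cancel_left s g⟩
  rw [nsmul_eq_mul, nsmul_eq_mul, ← mul_assoc] at hcount
  have h1 := le_of_mul_le_mul_right hcount hSpos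
  have h2 : ((S * W).filter N).card ≤
      (W.filter N).card + ((S * W) \ W).card := by
    refine (Finset.card_le_card fun x hx => ?_).trans (Finset.card_union_le _ _)
    obtain ⟨hx, hxN⟩ := Finset.mem_filter.1 hx
    by_cases h : x ∈ W
    · exact Finset.mem_union_left _ (Finset.mem_filter.2 ⟨h, hxN⟩)
    · exact Finset.mem_union_right _ (Finset.mem_sdiff.2 ⟨hx, h⟩)
  have h2' : (((S * W).filter N).card : ℝ) ≤
      (W.filter N).card + ((S * W) \ W).card := by exact_mod_cast h2
  linarith

/-- Asymptotically along `F`, the complement of `H` occupies at most a `u`-fraction of every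
right translate. -/
def UncoveredLE (F : ℕ → Finset G) (H : Set G) (u : ℝ) : Prop :=
  ∀ η > 0, ∀ᶠ m in atTop, ∀ g,
    (((rMul (F m) g).filter (fun x => x ∉ H)).card : ℝ) ≤ (u + η) * (F m).card

theorem UncoveredLE.step {F : ℕ → Finset G} (hF : IsFolnerSeq F) (𝒯 : Quasitiling G)
    {ε D u : ℝ} (hε : ε ∈ Set.Ioo (0 : ℝ) 1) (h𝒯 : 𝒯.EpsDisjoint ε) (hD : 0 ≤ D) (hD1 : D ≤ 1)
    {S : Finset G} (hS : (1 : G) ∈ S)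
    (hinv : ∀ T ∈ 𝒯.shapes, (((S⁻¹ * T) \ T).card : ℝ) ≤ D * ((1 - ε) * T.card))
    {H : Set G} (hH : 𝒯.union ⊆ H)
    (hcov : ∀ g, (∀ x ∈ rMul S g, x ∉ 𝒯.union) →
        ε * (S.card : ℝ) ≤ ((rMul S g).filter (fun x => x ∈ H)).card)
    (hu : UncoveredLE F 𝒯.union u) : UncoveredLE F H ((1 - ε) * u + ε * D) := by
  obtain ⟨hε0, hε1⟩ := hε
  intro η hη
  have hη3 : 0 < η / 3 := by positivity
  set K := 𝒯.shapes.biUnion fun T => T * T⁻¹ * S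
  filter_upwards [hu _ hη3, hF.eventually_card_mul_sdiff_le K hη3,
    hF.eventually_card_mul_sdiff_le S hη3] with m hm hmK hmS g
  set W := rMul (F m) g with hW
  have hWcard : W.card = (F m).card := card_rMul _ _
  set A := W.filter fun a => ∀ x ∈ rMul S a, x ∉ 𝒯.union
  have hAN := mul_card_le_card_add_boundary S ⟨1, hS⟩ W A (Finset.filter_subset _ _)
    (fun x => x ∈ H ∧ x ∉ 𝒯.union) (ε := ε) (by
      intro a ha
      have ha := (Finset.mem_filter.1 ha).2
      refine (hcov a ha).trans ?_
      norm_cast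
      refine Finset.card_le_card fun x hx => ?_
      obtain ⟨hx, hxH⟩ := Finset.mem_filter.1 hx
      exact Finset.mem_filter.2 ⟨hx, hxH, ha x hx⟩)
  have hB := card_boundary_le 𝒯 h𝒯 hD S hinv W
  set B := W.filter fun a => a ∉ 𝒯.union ∧ ∃ x ∈ rMul S a, x ∈ 𝒯.union
  have hAB : (W.filter (fun x => x ∉ 𝒯.union)).card ≤ A.card + B.card := by
    refine (Finset.card_le_card fun x hx => ?_).trans (Finset.card_union_le _ _)
    obtain ⟨hx, hxU⟩ := Finset.mem_filter.1 hx
    by_cases h : ∃ y ∈ rMul S x, y ∈ 𝒯.union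
    · exact Finset.mem_union_right _ (Finset.mem_filter.2 ⟨hx, hxU, h⟩)
    · push Not at h
      exact Finset.mem_union_left _ (Finset.mem_filter.2 ⟨hx, h⟩)
  have hsplit : (W.filter (fun x => x ∉ H)).card + (W.filter (fun x => x ∈ H ∧ x ∉ 𝒯.union)).card ≤
      (W.filter (fun x => x ∉ 𝒯.union)).card := by
    rw [← Finset.card_union_of_disjoint]
    · refine Finset.card_le_card fun x hx => ?_
      rcases Finset.mem_union.1 hx with hx | hx <;> obtain ⟨hx, hxH⟩ := Finset.mem_filter.1 hx
      · exact Finset.mem_filter.2 ⟨hx, fun h => hxH (hH h)⟩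
      · exact Finset.mem_filter.2 ⟨hx, hxH.2⟩
    · rw [Finset.disjoint_left]
      intro x hx hx'
      exact (Finset.mem_filter.1 hx).2 (Finset.mem_filter.1 hx').2.1
  have hKW : (K * W).card ≤ (F m).card + ((K * F m) \ F m).card := by
    rw [← card_mul_rMul_sdiff K (F m) g, ← hW, ← hWcard, add_comm]
    exact Finset.card_le_card_sdiff_add_card
  have hSW : (((S * W) \ W).card : ℝ) ≤ η / 3 * (F m).card := by
    rw [hW, card_mul_rMul_sdiff]
    exact hmS
  have hAB' : ((W.filter (fun x => x ∉ 𝒯.union)).card : ℝ) ≤ A.card + B.card := by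
    exact_mod_cast hAB
  have hsplit' : ((W.filter (fun x => x ∉ H)).card : ℝ) +
      (W.filter (fun x => x ∈ H ∧ x ∉ 𝒯.union)).card ≤ (W.filter (fun x => x ∉ 𝒯.union)).card := by
    exact_mod_cast hsplit
  have hKW' : ((K * W).card : ℝ) ≤ (1 + η / 3) * (F m).card := by
    have : ((K * W).card : ℝ) ≤ (F m).card + ((K * F m) \ F m).card := by exact_mod_cast hKW
    linarith
  have hm' := hm g
  set w : ℝ := ((F m).card : ℝ)
  have hw : 0 ≤ w := Nat.cast_nonneg _
  have hB' : (B.card : ℝ) ≤ D * w + η / 3 * w := by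
    have h1 : D * ((K * W).card : ℝ) ≤ D * ((1 + η / 3) * w) := mul_le_mul_of_nonneg_left hKW' hD
    have h2 : D * (η / 3 * w) ≤ 1 * (η / 3 * w) :=
      mul_le_mul_of_nonneg_right hD1 (by positivity)
    linarith
  have h3 : ε * ((W.filter (fun x => x ∉ 𝒯.union)).card : ℝ) ≤ ε * (A.card + B.card) :=
    mul_le_mul_of_nonneg_left hAB' hε0.le
  have h4 : ε * (B.card : ℝ) ≤ ε * (D * w + η / 3 * w) := mul_le_mul_of_nonneg_left hB' hε0.le
  have h5 : (1 - ε) * ((W.filter (fun x => x ∉ 𝒯.union)).card : ℝ) ≤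
      (1 - ε) * ((u + η / 3) * w) := mul_le_mul_of_nonneg_left hm' (by linarith)
  have h6 : 0 ≤ η / 3 * w := by positivity
  linarith

theorem one_sub_le_lowerBD {F : ℕ → Finset G} (hF : IsFolnerSeq F) {H : Set G} {u ε : ℝ}
    (hu : UncoveredLE F H u) (h : u < ε) : 1 - ε ≤ lowerBD H := by
  obtain ⟨m, hm⟩ := (hu (ε - u) (by linarith)).exists
  have hpos : (0 : ℝ) < (F m).card := by exact_mod_cast (hF.1 m).card_pos
  have hlow : 1 - ε ≤ lowerD H (F m) := by
    refine le_ciInf fun g => ?_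
    rw [le_div_iff₀ hpos]
    have h1 : (((rMul (F m) g).filter (fun x => x ∈ H)).card : ℝ) +
        ((rMul (F m) g).filter (fun x => x ∉ H)).card = (F m).card := by
      rw [← card_rMul (F m) g]
      exact_mod_cast Finset.card_filter_add_card_filter_not _
    have h2 := hm g
    have h3 : (interCard H (F m) g : ℝ) = ((rMul (F m) g).filter (fun x => x ∈ H)).card := rfl
    rw [h3]
    linarith
  refine hlow.trans (le_csSup ⟨1, ?_⟩ ⟨F m, hF.1 m, rfl⟩)
  rintro _ ⟨E, -, rfl⟩
  refine (ciInf_le ⟨0, ?_⟩ 1).trans (div_le_one_of_le₀ ?_ (Nat.cast_nonneg _))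
  · rintro _ ⟨g, rfl⟩
    positivity
  · rw [← card_rMul E 1]
    exact_mod_cast Finset.card_filter_le _ _

/-- From a sequence of shapes, each almost invariant under the previous ones, one builds
`ε`-disjoint quasitilings with the first `k` shapes leaving a fraction exponentially small in `k`
uncovered. -/
theorem exists_quasitiling_of_invariant [Countable G] {F : ℕ → Finset G} (hF : IsFolnerSeq F)
    {ε D : ℝ} (hε : ε ∈ Set.Ioo (0 : ℝ) 1) (hD : 0 ≤ D) (hD1 : D ≤ 1) (k : ℕ)
    (s : ℕ → Finset G) (hone : ∀ i, (1 : G) ∈ s i)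
    (hs : ∀ i j, i < j → s i ≠ s j ∧
      ((((s i)⁻¹ * s j) \ s j).card : ℝ) ≤ D * ((1 - ε) * (s j).card)) :
    ∃ 𝒯 : Quasitiling G, 𝒯.shapes = (Finset.range k).image s ∧ 𝒯.EpsDisjoint ε ∧
      UncoveredLE F 𝒯.union ((1 - ε) ^ k + D) := by
  induction k generalizing s with
  | zero =>
    let 𝒯 : Quasitiling G :=
      { shapes := ∅
        centers := fun _ => ∅
        one_mem := by simp
        centers_empty := by simp
        centers_disjoint := by simp
        tiles_inj := by simp }
    refine ⟨𝒯, rfl, ⟨fun _ _ => ∅, ?_, ?_⟩, ?_⟩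
    · intro S c h
      exact absurd h.1 (Finset.notMem_empty S)
    · intro S c S' c' h
      exact absurd h.1 (Finset.notMem_empty S)
    · intro η hη
      refine Eventually.of_forall fun m g => ?_
      have h1 : (((rMul (F m) g).filter (fun x => x ∉ 𝒯.union)).card : ℝ) ≤ (F m).card := by
        rw [← card_rMul (F m) g]
        exact_mod_cast Finset.card_filter_le _ _
      have h2 : (0 : ℝ) ≤ (F m).card := Nat.cast_nonneg _
      rw [pow_zero]
      nlinarith
  | succ k ih =>
    obtain ⟨𝒯, hshape, hdisj, hunc⟩ := ih (fun i => s (i + 1)) (fun i => hone _)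
      (fun i j hij => hs _ _ (by omega))
    have hmem : ∀ T ∈ 𝒯.shapes, ∃ i, T = s (i + 1) := by
      intro T hT
      rw [hshape] at hT
      obtain ⟨i, -, rfl⟩ := Finset.mem_image.1 hT
      exact ⟨i, rfl⟩
    obtain ⟨𝒯', hshape', hdisj', hsub, hcov⟩ := exists_insert_shape 𝒯 hε hdisj (s 0) (hone 0) (by
      intro h
      obtain ⟨i, hi⟩ := hmem _ h
      exact (hs 0 (i + 1) (by omega)).1 hi)
    refine ⟨𝒯', ?_, hdisj', ?_⟩
    · rw [hshape', hshape, Finset.range_add_one', Finset.image_insert, Finset.map_eq_image,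
        Finset.image_image]
      rfl
    · have hstep := hunc.step hF 𝒯 hε hdisj hD hD1 (hone 0) (by
        intro T hT
        obtain ⟨i, rfl⟩ := hmem T hT
        exact (hs 0 (i + 1) (by omega)).2) hsub hcov
      convert hstep using 1
      ring

end Auxiliary

/-- Ornstein–Weiss: given a Følner sequence of symmetric sets containing
the identity in an infinite countable amenable group and `ε ∈ (0,1)`, there is `r = r(ε)`
such that for every `n₀` there exist indices `n₀ < n 0 < ⋯ < n (r-1)` and an
`ε`-disjoint, `(1-ε)`-covering quasitiling whose shapes are exactly `F (n 0), …, F (n (r-1))`. -/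
theorem statement11 {G : Type*} [Group G] [Countable G] [Infinite G]
    (F : ℕ → Finset G) (hF : IsFolnerSeq F)
    (hsymm : ∀ n, (F n)⁻¹ = F n) (hone : ∀ n, (1 : G) ∈ F n)
    (ε : ℝ) (hε : ε ∈ Set.Ioo (0 : ℝ) 1) :
    ∃ r : ℕ, 0 < r ∧ ∀ n₀ : ℕ, ∃ n : Fin r → ℕ,
      StrictMono n ∧ (∀ i, n₀ < n i) ∧
      ∃ 𝒯 : Quasitiling G,
        𝒯.shapes = Finset.image (fun i => F (n i)) Finset.univ ∧
        𝒯.EpsDisjoint ε ∧ 𝒯.Covering (1 - ε) := by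
  have hε0 := hε.1
  have hε1 := hε.2
  obtain ⟨r, hr⟩ := exists_pow_lt_of_lt_one (show (0 : ℝ) < ε / 2 by linarith)
    (show 1 - ε < 1 by linarith)
  refine ⟨r + 1, Nat.succ_pos r, fun n₀ => ?_⟩
  obtain ⟨φ, hφ, hφ₀, hinv⟩ := hF.exists_invariant_subseq hone
    (show 0 < ε / 2 * (1 - ε) from mul_pos (by linarith) (by linarith)) n₀
  obtain ⟨𝒯, hshape, hdisj, hunc⟩ := exists_quasitiling_of_invariant hF hε (D := ε / 2)
    (by linarith) (by linarith) (r + 1) (fun i => F (φ i)) (fun i => hone _)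
    (fun i j hij => by simpa only [mul_assoc] using hinv i j hij)
  refine ⟨fun i => φ i, fun i j hij => hφ hij, fun i => hφ₀ i, 𝒯, ?_, hdisj,
    one_sub_le_lowerBD hF hunc ?_⟩
  · rw [hshape]
    ext S
    simp only [Finset.mem_image, Finset.mem_range, Finset.mem_univ, true_and]
    exact ⟨fun ⟨i, hi, h⟩ => ⟨⟨i, hi⟩, h⟩, fun ⟨i, h⟩ => ⟨i, i.2, h⟩⟩
  · have : (1 - ε) ^ (r + 1) ≤ (1 - ε) ^ r :=
      pow_le_pow_of_le_one (by linarith) (by linarith) (Nat.le_succ r)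
    linarith

end AmenableTilings
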